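/- arXiv:2312.01057 — 2 statements merged into one kernel-verified Lean document; each statement's English description precedes it below -/
import Mathlib

section
/- (Proposition 2, DPO failure.) Assume the dichotomy data model with query size k ≥ 3, ζ = P_π̄(M1) ∈ (0,1), p*(1) ∈ (0,1), and p*(1) < F(ζ) where F(ζ) = (ζ - ζ^k)/(1 - ζ^k - (1-ζ)^k). Let θ̂ be a minimizer of L_DPO(π_θ) over θ ∈ ℝ² if a minimizer exists and θ̂ = 0 otherwise. Then as the dataset size n → ∞, P_{π_θ̂}(M1) → 0 in probability and P_{π_θ̂}(M2) → 1 in probability. -/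
open MeasureTheory Filter Finset Real

/-- Number of category-1 messages in a query, given the vector of category
indicators of its `k` messages (`true` = category 1). -/
def catCount {k : ℕ} (v : Fin k → Bool) : ℕ := (Finset.univ.filter fun j => v j = true).card

/-- Probability that the chosen message is of category 1, given the category
pattern `v` of the query: the annotator's type is 1 with probability `p1`; the
choice is uniform on the messages of the annotator's category if present, and
uniform on the whole query otherwise. -/
noncomputable def chooseCat1Prob {k : ℕ} (p1 : ℝ) (v : Fin k → Bool) : ℝ :=
  if ∀ j, v j = true then 1 else if ∃ j, v j = true then p1 else 0

/-- Probability of a single datum pattern `(v, c)` in the dichotomy data model: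
`v j` is the category indicator of the `j`-th message of the query (each message
is of category 1 independently with probability `ζ = P_π̄(M1)`, the base policy
being uniform within each category), and `c` is the category of the chosen
message. -/
noncomputable def datumProb {k : ℕ} (ζ p1 : ℝ) (d : (Fin k → Bool) × Bool) : ℝ :=
  (∏ j, if d.1 j then ζ else 1 - ζ) *
    (if d.2 then chooseCat1Prob p1 d.1 else 1 - chooseCat1Prob p1 d.1)

/-- Total probability `P_{π_θ}(M1)` assigned by the policy `π_θ` to the `m1`
category-1 messages, for the two-parameter policy architecture
`P_{π_θ}(x) = e^{θ_z}/(m1 e^{θ1} + m2 e^{θ2})` for `x` of category `z`. -/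
noncomputable def polM1 (m1 m2 : ℕ) (θ : ℝ × ℝ) : ℝ :=
  m1 * exp θ.1 / (m1 * exp θ.1 + m2 * exp θ.2)

/-- Total probability `P_{π_θ}(M2)` assigned by the policy `π_θ` to the `m2`
category-2 messages. -/
noncomputable def polM2 (m1 m2 : ℕ) (θ : ℝ × ℝ) : ℝ :=
  m2 * exp θ.2 / (m1 * exp θ.1 + m2 * exp θ.2)

/-- The DPO loss
`L_DPO(π_θ) = -Σ_{(Y,y)∈D} ln( (P_{π_θ}(y)/P_π̄(y))^{β/n} / Σ_{y'∈Y} (P_{π_θ}(y')/P_π̄(y'))^{β/n} )`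
written in terms of the dataset's category pattern, where the base distribution
is uniform within each category with `P_π̄(M1) = ζ`, so that for a message of
category 1 the ratio is `P_{π_θ}(x)/P_π̄(x) = (e^{θ1}/(m1 e^{θ1}+m2 e^{θ2}))/(ζ/m1)`
and similarly for category 2. -/
noncomputable def dpoLoss (m1 m2 : ℕ) (ζ β : ℝ) {k n : ℕ}
    (d : Fin n → (Fin k → Bool) × Bool) (θ : ℝ × ℝ) : ℝ :=
  -∑ i,
    log ((if (d i).2
        then ((exp θ.1 / (m1 * exp θ.1 + m2 * exp θ.2)) / (ζ / m1)) ^ (β / (n : ℝ))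
        else ((exp θ.2 / (m1 * exp θ.1 + m2 * exp θ.2)) / ((1 - ζ) / m2)) ^ (β / (n : ℝ))) /
      ((catCount (d i).1 : ℝ) *
          ((exp θ.1 / (m1 * exp θ.1 + m2 * exp θ.2)) / (ζ / m1)) ^ (β / (n : ℝ)) +
        ((k : ℝ) - (catCount (d i).1 : ℝ)) *
          ((exp θ.2 / (m1 * exp θ.1 + m2 * exp θ.2)) / ((1 - ζ) / m2)) ^ (β / (n : ℝ))))

/-- A function with positive derivative at `0` takes smaller values just to the left of `0`. -/
theorem exists_neg_lt_of_hasDerivAt_pos {f : ℝ → ℝ} {d : ℝ} (hf : HasDerivAt f d 0)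
    (hd : 0 < d) : ∃ b < 0, f b < f 0 := by
  have h := (hasDerivAt_iff_tendsto_slope.1 hf).eventually (lt_mem_nhds hd)
  have h' := h.filter_mono (nhdsWithin_mono 0 (s := Set.Iio 0) fun x hx => (Set.mem_Iio.1 hx).ne)
  obtain ⟨b, hb, hb0⟩ := (h'.and self_mem_nhdsWithin).exists
  have hb0 : b < 0 := hb0
  refine ⟨b, hb0, ?_⟩
  rw [slope_def_field, sub_zero] at hb
  rcases div_pos_iff.1 hb with h | h <;> linarith [h.1, h.2]

/-- Chernoff bound: under i.i.d. sampling from a finite distribution `q`, the empirical sum of a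
function with positive mean is positive with probability tending to `1`. -/
theorem tendsto_sum_prod_ite_sum_nonpos {X : Type*} [Fintype X] (q f : X → ℝ)
    (hq : ∀ x, 0 ≤ q x) (hq1 : ∑ x, q x = 1) (hf : 0 < ∑ x, q x * f x) :
    Tendsto (fun n : ℕ => ∑ d : Fin n → X, if ∑ i, f (d i) ≤ 0 then ∏ i, q (d i) else 0)
      atTop (nhds 0) := by
  have hder : HasDerivAt (fun s => ∑ x, q x * exp (s * f x)) (∑ x, q x * f x) 0 := by
    refine HasDerivAt.fun_sum fun x _ => ?_
    have := (((hasDerivAt_id (0 : ℝ)).mul_const (f x)).exp).const_mul (q x)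
    simpa using this
  obtain ⟨s, hs, hlt⟩ := exists_neg_lt_of_hasDerivAt_pos hder hf
  simp only [zero_mul, exp_zero, mul_one, hq1] at hlt
  have h0 : 0 ≤ ∑ x, q x * exp (s * f x) :=
    sum_nonneg fun x _ => mul_nonneg (hq x) (exp_pos _).le
  refine squeeze_zero (fun n => sum_nonneg fun d _ => ?_) (fun n => ?_)
    (tendsto_pow_atTop_nhds_zero_of_lt_one h0 hlt)
  · split_ifs
    · exact prod_nonneg fun i _ => hq _
    · exact le_rfl
  · have : (∑ x, q x * exp (s * f x)) ^ n = ∑ d : Fin n → X, ∏ i, q (d i) * exp (s * f (d i)) := by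
      have := prod_univ_sum (fun _ : Fin n => univ) (fun _ x => q x * exp (s * f x))
      simpa using this
    rw [this]
    refine sum_le_sum fun d _ => ?_
    rw [prod_mul_distrib, ← exp_sum, ← mul_sum]
    have hp : 0 ≤ ∏ i, q (d i) := prod_nonneg fun i _ => hq _
    split_ifs with h
    · exact le_mul_of_one_le_right hp (one_le_exp (mul_nonneg_of_nonpos_of_nonpos hs.le h))
    · positivity

/-- If a random element `D` of a finite type has point masses `w`, then the probability of an
event is at most the sum of the masses of the points in it. No measurability is needed. -/
theorem measure_le_ofReal_sum_ite {Ω Y : Type*} [MeasurableSpace Ω] [Fintype Y] (μ : Measure Ω)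
    (D : Ω → Y) (w : Y → ℝ) (hw : ∀ y, 0 ≤ w y) (hD : ∀ y, μ {ω | D ω = y} = ENNReal.ofReal (w y))
    (P : Y → Prop) [DecidablePred P] :
    μ {ω | P (D ω)} ≤ ENNReal.ofReal (∑ y, if P y then w y else 0) := by
  rw [← sum_filter, ENNReal.ofReal_sum_of_nonneg fun y _ => hw y]
  calc μ {ω | P (D ω)} ≤ μ (⋃ y ∈ univ.filter P, {ω | D ω = y}) :=
        measure_mono fun ω hω => by simpa using hω
    _ ≤ ∑ y ∈ univ.filter P, μ {ω | D ω = y} := measure_biUnion_finset_le _ _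
    _ = _ := sum_congr rfl fun y _ => hD y

theorem catCount_le {k : ℕ} (v : Fin k → Bool) : catCount v ≤ k := by
  simpa [catCount] using card_filter_le (univ : Finset (Fin k)) (fun j => v j = true)

theorem catCount_lt {k : ℕ} {v : Fin k → Bool} (h : ∃ j, v j = false) : catCount v < k := by
  obtain ⟨j, hj⟩ := h
  have : (univ.filter fun j => v j = true) ⊂ (univ : Finset (Fin k)) :=
    (filter_ssubset).2 ⟨j, mem_univ _, by simp [hj]⟩
  simpa [catCount] using card_lt_card this

/-- The per-datum DPO loss as a function of the log-odds `t` of the categories. -/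
noncomputable def logitLoss {k : ℕ} (x : (Fin k → Bool) × Bool) (t : ℝ) : ℝ :=
  log (catCount x.1 * exp t + ((k : ℝ) - catCount x.1)) - if x.2 then t else 0

theorem mul_exp_add_sub_pos {a K : ℝ} (ha : 0 ≤ a) (haK : a ≤ K) (hK : 0 < K) (t : ℝ) :
    0 < a * exp t + (K - a) := by
  rcases ha.eq_or_lt with rfl | h
  · simpa using hK
  · have := exp_pos t
    have := mul_pos h this
    linarith

theorem catCount_mul_exp_add_pos {k : ℕ} (hk : 0 < k) (v : Fin k → Bool) (t : ℝ) :
    0 < catCount v * exp t + ((k : ℝ) - catCount v) :=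
  mul_exp_add_sub_pos (Nat.cast_nonneg _) (by exact_mod_cast catCount_le v)
    (by exact_mod_cast hk) t

theorem hasDerivAt_logitLoss {k : ℕ} (hk : 0 < k) (x : (Fin k → Bool) × Bool) (t : ℝ) :
    HasDerivAt (logitLoss x)
      (catCount x.1 * exp t / (catCount x.1 * exp t + ((k : ℝ) - catCount x.1)) -
        if x.2 then 1 else 0) t := by
  have h1 := (((Real.hasDerivAt_exp t).const_mul (catCount x.1 : ℝ)).add_const
    ((k : ℝ) - catCount x.1)).log (catCount_mul_exp_add_pos hk x.1 t).ne'
  refine h1.sub ?_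
  split_ifs
  · exact hasDerivAt_id t
  · exact hasDerivAt_const t 0

theorem convexOn_logitLoss {k : ℕ} (hk : 0 < k) (x : (Fin k → Bool) × Bool) :
    ConvexOn ℝ Set.univ (logitLoss x) := by
  refine Monotone.convexOn_univ_of_deriv
    (fun t => (hasDerivAt_logitLoss hk x t).differentiableAt) fun s t hst => ?_
  rw [(hasDerivAt_logitLoss hk x s).deriv, (hasDerivAt_logitLoss hk x t).deriv]
  have ha : (0 : ℝ) ≤ catCount x.1 := Nat.cast_nonneg _
  have hb : (0 : ℝ) ≤ (k : ℝ) - catCount x.1 :=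
    sub_nonneg.2 (by exact_mod_cast catCount_le x.1)
  gcongr ?_ - _
  rw [div_le_div_iff₀ (catCount_mul_exp_add_pos hk x.1 s) (catCount_mul_exp_add_pos hk x.1 t)]
  have := mul_le_mul_of_nonneg_left (exp_le_exp.2 hst) (mul_nonneg ha hb)
  nlinarith

theorem neg_le_logitLoss {k : ℕ} {x : (Fin k → Bool) × Bool}
    (hx : x.2 = true ∧ ∃ j, x.1 j = false) (t : ℝ) : -t ≤ logitLoss x t := by
  have h : (catCount x.1 : ℝ) + 1 ≤ k := by exact_mod_cast catCount_lt hx.2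
  have := log_nonneg (x := catCount x.1 * exp t + ((k : ℝ) - catCount x.1)) (by
    have : 0 ≤ catCount x.1 * exp t := by positivity
    linarith)
  simp only [logitLoss, hx.1, if_true]
  linarith

theorem logitLoss_nonneg {k : ℕ} (hk : 0 < k) {x : (Fin k → Bool) × Bool}
    (hx : x.2 = false → ∃ j, x.1 j = false) {t : ℝ} (ht : t ≤ 0) : 0 ≤ logitLoss x t := by
  have hc := catCount_le x.1
  have hc' : (catCount x.1 : ℝ) ≤ k := by exact_mod_cast hc
  cases h : x.2
  · have h' : (catCount x.1 : ℝ) + 1 ≤ k := by exact_mod_cast catCount_lt (hx h)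
    have := log_nonneg (x := catCount x.1 * exp t + ((k : ℝ) - catCount x.1)) (by
      have : 0 ≤ catCount x.1 * exp t := by positivity
      linarith)
    simpa [logitLoss, h] using this
  · have hk1 : (1 : ℝ) ≤ k := by exact_mod_cast hk
    have he : exp t ≤ 1 := exp_le_one_iff.2 ht
    have : exp t ≤ catCount x.1 * exp t + ((k : ℝ) - catCount x.1) := by nlinarith [exp_pos t]
    have := (le_log_iff_exp_le (catCount_mul_exp_add_pos hk x.1 t)).2 this
    simp only [logitLoss, h, if_true]
    linarith

/-- If the total logit loss is smaller at `b` than at `a > b`, then by convexity it stays above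
its value at `b` to the right of `a`. -/
theorem sum_logitLoss_lt {k n : ℕ} (hk : 0 < k) (d : Fin n → (Fin k → Bool) × Bool)
    {a b t : ℝ} (hba : b < a) (hab : ∑ i, logitLoss (d i) b < ∑ i, logitLoss (d i) a)
    (hat : a ≤ t) : ∑ i, logitLoss (d i) b < ∑ i, logitLoss (d i) t := by
  have hconv : ConvexOn ℝ Set.univ (fun t => ∑ i, logitLoss (d i) t) := by
    refine ⟨convex_univ, fun x hx y hy u v hu hv huv => ?_⟩
    rw [smul_sum, smul_sum, ← sum_add_distrib]
    exact sum_le_sum fun i _ => (convexOn_logitLoss hk (d i)).2 hx hy hu hv huv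
  by_contra! h
  have := hconv.le_max_of_mem_Icc (Set.mem_univ b) (Set.mem_univ t) ⟨hba.le, hat⟩
  rw [max_eq_left h] at this
  exact absurd hab (not_lt.2 this)

/-- The total logit loss attains its minimum for a nondegenerate dataset. -/
theorem exists_min_sum_logitLoss {k n : ℕ} (hk : 0 < k) (d : Fin n → (Fin k → Bool) × Bool)
    {a b : ℝ} (hba : b < a) (ha : a < 0)
    (hab : ∑ i, logitLoss (d i) b < ∑ i, logitLoss (d i) a)
    (hd : ∀ i, (d i).2 = false → ∃ j, (d i).1 j = false)
    (hd' : ∃ i, (d i).2 = true ∧ ∃ j, (d i).1 j = false) :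
    ∃ t, ∀ t', ∑ i, logitLoss (d i) t ≤ ∑ i, logitLoss (d i) t' := by
  set g : ℝ → ℝ := fun t => ∑ i, logitLoss (d i) t with hg
  have hcont : Continuous g := continuous_finsetSum _ fun i _ =>
    continuous_iff_continuousAt.2 fun t => (hasDerivAt_logitLoss hk (d i) t).continuousAt
  have hlow : ∀ t ≤ 0, -t ≤ g t := fun t ht => by
    obtain ⟨i, hi⟩ := hd'
    exact (neg_le_logitLoss hi t).trans
      (single_le_sum (f := fun i => logitLoss (d i) t)
        (fun j _ => logitLoss_nonneg hk (hd j) ht) (mem_univ i))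
  set c := min b (-g b)
  obtain ⟨t, -, ht⟩ := (isCompact_Icc (a := c) (b := a)).exists_isMinOn
    ⟨b, min_le_left _ _, hba.le⟩ hcont.continuousOn
  have htb : g t ≤ g b := ht ⟨min_le_left _ _, hba.le⟩
  refine ⟨t, fun t' => ?_⟩
  rcases lt_or_ge t' c with h | h
  · have h1 : t' < -g b := h.trans_le (min_le_right _ _)
    have h2 : t' < b := h.trans_le (min_le_left _ _)
    have := hlow t' (by linarith)
    change g t ≤ g t'
    linarith
  · rcases le_or_gt t' a with h' | h'
    · exact ht ⟨h, h'⟩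
    · exact htb.trans (sum_logitLoss_lt hk d hba hab h'.le).le

theorem sum_prod_bool {k : ℕ} (g : Fin k → Bool → ℝ) :
    ∑ v : Fin k → Bool, ∏ j, g j (v j) = ∏ j, (g j true + g j false) := by
  rw [← Fintype.piFinset_univ, ← Finset.prod_univ_sum]
  simp

theorem sum_prod_ite {k : ℕ} (ζ : ℝ) :
    ∑ v : Fin k → Bool, ∏ j, (if v j then ζ else 1 - ζ) = 1 := by
  rw [sum_prod_bool (fun _ b => if b then ζ else 1 - ζ)]
  simp

/-- The expected number of category-1 messages in a query. -/
theorem sum_prod_ite_mul_catCount {k : ℕ} (ζ : ℝ) :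
    ∑ v : Fin k → Bool, (∏ j, (if v j then ζ else 1 - ζ)) * (catCount v : ℝ) = k * ζ := by
  have h (v : Fin k → Bool) : (∏ j, (if v j then ζ else 1 - ζ)) * (catCount v : ℝ) =
      ∑ i, ∏ j, (if v j then ζ else if j = i then 0 else 1 - ζ) := by
    rw [catCount, card_eq_sum_ones, Nat.cast_sum, sum_filter, mul_sum]
    refine sum_congr rfl fun i _ => ?_
    by_cases hi : v i = true
    · simp only [hi, if_true, Nat.cast_one, mul_one]
      refine prod_congr rfl fun j _ => ?_
      by_cases hj : j = i
      · subst hj; simp [hi]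
      · simp [hj]
    · rw [if_neg hi, mul_zero, eq_comm]
      exact prod_eq_zero (mem_univ i) (by simp [hi])
  simp_rw [h]
  rw [sum_comm]
  have h' (i : Fin k) : ∑ v : Fin k → Bool,
      ∏ j, (if v j then ζ else if j = i then 0 else 1 - ζ) = ζ := by
    rw [sum_prod_bool (fun j b => if b then ζ else if j = i then 0 else 1 - ζ),
      prod_eq_single i (fun j _ hj => by simp [hj]) (by simp)]
    simp
  simp [h']

/-- The probability that the chosen message is of category 1. -/
theorem sum_prod_ite_mul_chooseCat1Prob {k : ℕ} (hk : 0 < k) (ζ p1 : ℝ) :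
    ∑ v : Fin k → Bool, (∏ j, (if v j then ζ else 1 - ζ)) * chooseCat1Prob p1 v =
      ζ ^ k + p1 * (1 - ζ ^ k - (1 - ζ) ^ k) := by
  have h (v : Fin k → Bool) : (∏ j, (if v j then ζ else 1 - ζ)) * chooseCat1Prob p1 v =
      p1 * (∏ j, (if v j then ζ else 1 - ζ)) +
        ((if v = fun _ => true then (1 - p1) * ζ ^ k else 0) -
          if v = fun _ => false then p1 * (1 - ζ) ^ k else 0) := by
    unfold chooseCat1Prob
    by_cases h1 : v = fun _ => true
    · have : (fun _ : Fin k => true) ≠ fun _ => false := fun h =>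
        absurd (congrFun h ⟨0, hk⟩) (by simp)
      subst h1
      simp [this]
      ring
    by_cases h2 : v = fun _ => false
    · subst h2
      have : ¬ ∀ _ : Fin k, False := fun h => h ⟨0, hk⟩
      simp [h1, this]
    · have h1' : ¬ ∀ j, v j = true := fun h => h1 (funext h)
      have h2' : ∃ j, v j = true := by
        by_contra! h
        exact h2 (funext fun j => by simpa using h j)
      rw [if_neg h1', if_pos h2', if_neg h1, if_neg h2]
      ring
  simp_rw [h]
  rw [sum_add_distrib, ← mul_sum, sum_prod_ite, sum_sub_distrib]
  simp
  ring

theorem datumProb_nonneg {k : ℕ} {ζ p1 : ℝ} (hζ : ζ ∈ Set.Ioo (0 : ℝ) 1)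
    (hp1 : p1 ∈ Set.Ioo (0 : ℝ) 1) (x : (Fin k → Bool) × Bool) : 0 ≤ datumProb ζ p1 x := by
  obtain ⟨h1, h2⟩ := hζ
  obtain ⟨h3, h4⟩ := hp1
  refine mul_nonneg (prod_nonneg fun j _ => ?_) ?_
  · split_ifs <;> linarith
  · unfold chooseCat1Prob
    split_ifs <;> linarith

theorem sum_datumProb_mul {k : ℕ} (ζ p1 : ℝ) (f : (Fin k → Bool) × Bool → ℝ) :
    ∑ x, datumProb ζ p1 x * f x = ∑ v : Fin k → Bool, (∏ j, (if v j then ζ else 1 - ζ)) *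
      (chooseCat1Prob p1 v * f (v, true) + (1 - chooseCat1Prob p1 v) * f (v, false)) := by
  rw [Fintype.sum_prod_type]
  refine sum_congr rfl fun v _ => ?_
  simp [datumProb]
  ring

theorem sum_datumProb {k : ℕ} (ζ p1 : ℝ) :
    ∑ x : (Fin k → Bool) × Bool, datumProb ζ p1 x = 1 := by
  have := sum_datumProb_mul (k := k) ζ p1 (fun _ => 1)
  simpa [sum_prod_ite] using this

/-- The population DPO gradient at the base policy. -/
theorem sum_datumProb_mul_deriv {k : ℕ} (hk : 0 < k) (ζ p1 : ℝ) :
    ∑ x : (Fin k → Bool) × Bool,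
      datumProb ζ p1 x * ((catCount x.1 : ℝ) / k - if x.2 then 1 else 0) =
      ζ - (ζ ^ k + p1 * (1 - ζ ^ k - (1 - ζ) ^ k)) := by
  have hk' : (k : ℝ) ≠ 0 := by exact_mod_cast hk.ne'
  rw [← sum_prod_ite_mul_chooseCat1Prob hk, sum_datumProb_mul]
  have : ζ = (∑ v : Fin k → Bool,
      (∏ j, (if v j then ζ else 1 - ζ)) * (catCount v : ℝ)) / k := by
    rw [sum_prod_ite_mul_catCount]
    field_simp
  refine Eq.trans ?_ (congrArg (· - _) this.symm)
  rw [sum_div, ← sum_sub_distrib]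
  refine sum_congr rfl fun v _ => ?_
  simp
  ring

theorem exists_expected_logitLoss_lt {k : ℕ} (hk : 2 ≤ k) {ζ p1 : ℝ}
    (hζ : ζ ∈ Set.Ioo (0 : ℝ) 1)
    (hF : p1 < (ζ - ζ ^ k) / (1 - ζ ^ k - (1 - ζ) ^ k)) :
    ∃ a b, b < a ∧ a < 0 ∧
      0 < ∑ x : (Fin k → Bool) × Bool, datumProb ζ p1 x * (logitLoss x a - logitLoss x b) := by
  have hk0 : 0 < k := by omega
  have hden : 0 < 1 - ζ ^ k - (1 - ζ) ^ k := by
    have h1 : ζ ^ k < ζ := pow_lt_self_of_lt_one₀ hζ.1 hζ.2 (by omega)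
    have h2 : (1 - ζ) ^ k < 1 - ζ :=
      pow_lt_self_of_lt_one₀ (by linarith [hζ.2]) (by linarith [hζ.1]) (by omega)
    linarith
  rw [lt_div_iff₀ hden] at hF
  set H : ℝ → ℝ := fun t => ∑ x : (Fin k → Bool) × Bool, datumProb ζ p1 x * logitLoss x t
  have hder : HasDerivAt H (∑ x : (Fin k → Bool) × Bool,
      datumProb ζ p1 x * ((catCount x.1 : ℝ) / k - if x.2 then 1 else 0)) 0 := by
    refine HasDerivAt.fun_sum fun x _ => HasDerivAt.const_mul _ ?_
    simpa using hasDerivAt_logitLoss hk0 x 0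
  rw [sum_datumProb_mul_deriv hk0] at hder
  obtain ⟨b, hb, hlt⟩ := exists_neg_lt_of_hasDerivAt_pos hder (by linarith)
  have hev : ∀ᶠ a in nhdsWithin 0 (Set.Iio 0), H b < H a ∧ b < a :=
    ((hder.continuousAt.eventually (lt_mem_nhds hlt)).and (lt_mem_nhds hb)).filter_mono
      nhdsWithin_le_nhds
  obtain ⟨a, ⟨h1, h2⟩, h3⟩ := (hev.and self_mem_nhdsWithin).exists
  refine ⟨a, b, h2, h3, ?_⟩
  simp_rw [mul_sub]
  rw [sum_sub_distrib]
  exact sub_pos.2 h1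

theorem expected_mixed_pos {k : ℕ} (hk : 2 ≤ k) {ζ p1 : ℝ} (hζ : ζ ∈ Set.Ioo (0 : ℝ) 1)
    (hp1 : p1 ∈ Set.Ioo (0 : ℝ) 1) :
    0 < ∑ x : (Fin k → Bool) × Bool, datumProb ζ p1 x *
      (if x.2 = true ∧ ∃ j, x.1 j = false then 1 else 0) := by
  refine sum_pos' (fun x _ => mul_nonneg (datumProb_nonneg hζ hp1 x) (by split_ifs <;> simp))
    ⟨(fun j => decide (j.1 = 0), true), mem_univ _, ?_⟩
  have h0 : ∃ j : Fin k, decide (j.1 = 0) = true := ⟨⟨0, by omega⟩, by simp⟩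
  have h1 : ∃ j : Fin k, decide (j.1 = 0) = false := ⟨⟨1, by omega⟩, by simp⟩
  have h2 : ¬ ∀ j : Fin k, decide (j.1 = 0) = true := fun h => by
    obtain ⟨j, hj⟩ := h1
    simp [h j] at hj
  rw [if_pos ⟨rfl, h1⟩, mul_one, datumProb, chooseCat1Prob]
  dsimp only
  rw [if_neg h2, if_pos h0, if_pos rfl]
  refine mul_pos (prod_pos fun j _ => ?_) hp1.1
  split_ifs <;> linarith [hζ.1, hζ.2]

theorem exists_false_of_datumProb_ne_zero {k : ℕ} {ζ p1 : ℝ} {x : (Fin k → Bool) × Bool}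
    (h : datumProb ζ p1 x ≠ 0) (hx : x.2 = false) : ∃ j, x.1 j = false := by
  by_contra! h'
  have h'' : ∀ j, x.1 j = true := fun j => by simpa using h' j
  exact h (by simp [datumProb, hx, chooseCat1Prob, h''])

/-- The log-odds, to the power `β / n`, of the policy `π_θ` relative to the base policy. -/
noncomputable def relLogit (m1 m2 : ℕ) (ζ β : ℝ) (n : ℕ) (θ : ℝ × ℝ) : ℝ :=
  β / n * (θ.1 - θ.2 + log ((m1 / ζ) / (m2 / (1 - ζ))))

theorem dpoLoss_eq_sum_logitLoss {k m1 m2 n : ℕ} (hk : 0 < k) (hm1 : 1 ≤ m1) (hm2 : 1 ≤ m2)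
    {ζ : ℝ} (β : ℝ) (hζ : ζ ∈ Set.Ioo (0 : ℝ) 1) (d : Fin n → (Fin k → Bool) × Bool)
    (θ : ℝ × ℝ) :
    dpoLoss m1 m2 ζ β d θ = ∑ i, logitLoss (d i) (relLogit m1 m2 ζ β n θ) := by
  have h1 : (0 : ℝ) < m1 := by exact_mod_cast hm1
  have h2 : (0 : ℝ) < m2 := by exact_mod_cast hm2
  have hz : 0 < ζ := hζ.1
  have hz' : 0 < 1 - ζ := by linarith [hζ.2]
  rw [dpoLoss, ← sum_neg_distrib]
  refine sum_congr rfl fun i _ => ?_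
  set r2 := (exp θ.2 / (m1 * exp θ.1 + m2 * exp θ.2)) / ((1 - ζ) / m2) with hr2
  have hr2pos : 0 < r2 := by positivity
  have hr1 : (exp θ.1 / (m1 * exp θ.1 + m2 * exp θ.2)) / (ζ / m1) =
      exp (θ.1 - θ.2 + log ((m1 / ζ) / (m2 / (1 - ζ)))) * r2 := by
    rw [exp_add, exp_log (by positivity), exp_sub, hr2]
    field_simp
  have hpow : ((exp θ.1 / (m1 * exp θ.1 + m2 * exp θ.2)) / (ζ / m1)) ^ (β / (n : ℝ)) =
      exp (relLogit m1 m2 ζ β n θ) * r2 ^ (β / (n : ℝ)) := by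
    rw [hr1, mul_rpow (exp_pos _).le hr2pos.le, ← exp_mul, relLogit, mul_comm (β / (n : ℝ))]
  rw [hpow]
  have hR : 0 < r2 ^ (β / (n : ℝ)) := rpow_pos_of_pos hr2pos _
  set R := r2 ^ (β / (n : ℝ))
  set t := relLogit m1 m2 ζ β n θ
  have hpos := catCount_mul_exp_add_pos hk (d i).1 t
  have hsum : (catCount (d i).1 : ℝ) * (exp t * R) + ((k : ℝ) - catCount (d i).1) * R =
      (catCount (d i).1 * exp t + ((k : ℝ) - catCount (d i).1)) * R := by ring
  rw [hsum, logitLoss]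
  split_ifs
  · rw [mul_div_mul_right _ _ hR.ne', log_div (exp_pos t).ne' hpos.ne', log_exp]
    ring
  · rw [div_mul_cancel_right₀ hR.ne', log_inv]
    ring

theorem relLogit_surjective {m1 m2 n : ℕ} {ζ β : ℝ} (hβ : 0 < β) (hn : 0 < n) :
    Function.Surjective (relLogit m1 m2 ζ β n) := fun t => by
  have : (n : ℝ) ≠ 0 := by exact_mod_cast hn.ne'
  refine ⟨(n / β * t - log ((m1 / ζ) / (m2 / (1 - ζ))), 0), ?_⟩
  simp only [relLogit]
  field_simp
  ring

theorem polM1_add_polM2 {m1 m2 : ℕ} (hm1 : 1 ≤ m1) (θ : ℝ × ℝ) :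
    polM1 m1 m2 θ + polM2 m1 m2 θ = 1 := by
  have h1 : (0 : ℝ) < m1 := by exact_mod_cast hm1
  rw [polM1, polM2, ← add_div]
  exact div_self (by positivity)

theorem polM1_le {m1 m2 n : ℕ} (hm2 : 1 ≤ m2) {ζ β a : ℝ} (hβ : 0 < β) (hn : 0 < n)
    {θ : ℝ × ℝ} (h : relLogit m1 m2 ζ β n θ < a) :
    polM1 m1 m2 θ ≤ m1 / m2 * exp (a / β * n - log ((m1 / ζ) / (m2 / (1 - ζ)))) := by
  have h2 : (0 : ℝ) < m2 := by exact_mod_cast hm2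
  have hn' : (0 : ℝ) < n := by exact_mod_cast hn
  have hle : θ.1 - θ.2 ≤ a / β * n - log ((m1 / ζ) / (m2 / (1 - ζ))) := by
    rw [relLogit, div_mul_eq_mul_div, div_lt_iff₀ hn'] at h
    have : θ.1 - θ.2 + log ((m1 / ζ) / (m2 / (1 - ζ))) < a / β * n := by
      rw [div_mul_eq_mul_div, lt_div_iff₀ hβ]
      linarith
    linarith
  calc polM1 m1 m2 θ ≤ m1 * exp θ.1 / (m2 * exp θ.2) := by
        unfold polM1
        gcongr
        have : 0 ≤ m1 * exp θ.1 := by positivity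
        linarith
    _ = m1 / m2 * exp (θ.1 - θ.2) := by
        rw [exp_sub]
        field_simp
    _ ≤ _ := by gcongr

/-- With probability tending to `1` a dataset satisfies any property implied by: two empirical
sums of functions with positive mean are positive, and no datum has probability zero. -/
theorem tendsto_measure_of_two_sums {Ω X : Type*} [MeasurableSpace Ω] [Fintype X]
    (μ : Measure Ω) (D : (n : ℕ) → Fin n → Ω → X) (q f₁ f₂ : X → ℝ)
    (hq : ∀ x, 0 ≤ q x) (hq1 : ∑ x, q x = 1)
    (hD : ∀ n (d : Fin n → X), μ {ω | ∀ i, D n i ω = d i} = ENNReal.ofReal (∏ i, q (d i)))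
    (hf₁ : 0 < ∑ x, q x * f₁ x) (hf₂ : 0 < ∑ x, q x * f₂ x) (B : ℕ → Set Ω)
    (hB : ∀ᶠ n in atTop, ∀ ω, 0 < ∑ i, f₁ (D n i ω) → 0 < ∑ i, f₂ (D n i ω) →
      (∀ i, q (D n i ω) ≠ 0) → ω ∉ B n) :
    Tendsto (fun n => μ (B n)) atTop (nhds 0) := by
  classical
  have hbound (n : ℕ) (P : (Fin n → X) → Prop) :
      μ {ω | P fun i => D n i ω} ≤ ENNReal.ofReal (∑ d, if P d then ∏ i, q (d i) else 0) :=
    measure_le_ofReal_sum_ite μ (fun ω i => D n i ω) (fun d => ∏ i, q (d i))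
      (fun d => prod_nonneg fun i _ => hq _) (fun d => by simpa [funext_iff] using hD n d) P
  have hlim (f : X → ℝ) (hf : 0 < ∑ x, q x * f x) :
      Tendsto (fun n => μ {ω | ∑ i, f (D n i ω) ≤ 0}) atTop (nhds 0) := by
    have h := ENNReal.tendsto_ofReal (tendsto_sum_prod_ite_sum_nonpos q f hq hq1 hf)
    rw [ENNReal.ofReal_zero] at h
    refine tendsto_of_tendsto_of_tendsto_of_le_of_le tendsto_const_nhds h (fun _ => zero_le) ?_
    intro n
    convert hbound n (fun d => ∑ i, f (d i) ≤ 0)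
  have hnull (n : ℕ) : μ {ω | ∃ i, q (D n i ω) = 0} = 0 := by
    refine le_antisymm ((hbound n fun d => ∃ i, q (d i) = 0).trans ?_) zero_le
    rw [sum_eq_zero, ENNReal.ofReal_zero]
    intro d _
    split_ifs with h
    · obtain ⟨i, hi⟩ := h
      exact prod_eq_zero (mem_univ i) hi
    · rfl
  have hsum := (hlim f₁ hf₁).add (hlim f₂ hf₂)
  rw [add_zero] at hsum
  refine tendsto_of_tendsto_of_tendsto_of_le_of_le' tendsto_const_nhds hsum
    (Eventually.of_forall fun _ => zero_le) (hB.mono fun n hn => ?_)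
  calc μ (B n) ≤ μ (({ω | ∑ i, f₁ (D n i ω) ≤ 0} ∪ {ω | ∑ i, f₂ (D n i ω) ≤ 0}) ∪
        {ω | ∃ i, q (D n i ω) = 0}) := measure_mono fun ω hω => by
          by_contra hc
          simp only [Set.mem_union, Set.mem_ofPred_eq, not_or, not_le, not_exists] at hc
          exact hn ω hc.1.1 hc.1.2 hc.2 hω
    _ ≤ _ := (measure_union_le _ _).trans (by
          rw [hnull, add_zero]
          exact measure_union_le _ _)

/-- **Proposition 2 (DPO failure).**  Under the dichotomy data model with query
size `k ≥ 3`, `ζ = P_π̄(M1) ∈ (0,1)`, `p*(1) ∈ (0,1)` and `p*(1) < F(ζ)` where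
`F(ζ) = (ζ - ζ^k)/(1 - ζ^k - (1-ζ)^k)`, if `θ̂` is a minimizer of the DPO loss
when one exists and `0` otherwise, then `P_{π_θ̂}(M1) → 0` and `P_{π_θ̂}(M2) → 1`
in probability as the dataset size `n → ∞`. -/
theorem dpo_failure
    (k m1 m2 : ℕ) (hk : 3 ≤ k) (hm1 : 1 ≤ m1) (hm2 : 1 ≤ m2)
    (ζ p1 β : ℝ) (hζ : ζ ∈ Set.Ioo (0:ℝ) 1) (hp1 : p1 ∈ Set.Ioo (0:ℝ) 1) (hβ : 0 < β)
    (hF : p1 < (ζ - ζ ^ k) / (1 - ζ ^ k - (1 - ζ) ^ k))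
    (Ω : Type*) [MeasurableSpace Ω] (μ : Measure Ω) [IsProbabilityMeasure μ]
    -- the dataset of size `n`: `n` i.i.d. pattern-level data
    (D : (n : ℕ) → Fin n → Ω → (Fin k → Bool) × Bool)
    (hiid : ∀ n (dd : Fin n → (Fin k → Bool) × Bool),
      μ {ω | ∀ i, D n i ω = dd i} = ENNReal.ofReal (∏ i, datumProb ζ p1 (dd i)))
    (θhat : (n : ℕ) → Ω → ℝ × ℝ)
    -- `θ̂` is a minimizer of the DPO loss if one exists, and `0` otherwise
    (hθmin : ∀ n ω,
      (∃ θ, ∀ θ', dpoLoss m1 m2 ζ β (fun i => D n i ω) θ ≤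
        dpoLoss m1 m2 ζ β (fun i => D n i ω) θ') →
      ∀ θ', dpoLoss m1 m2 ζ β (fun i => D n i ω) (θhat n ω) ≤
        dpoLoss m1 m2 ζ β (fun i => D n i ω) θ')
    (hθzero : ∀ n ω,
      (¬ ∃ θ, ∀ θ', dpoLoss m1 m2 ζ β (fun i => D n i ω) θ ≤
        dpoLoss m1 m2 ζ β (fun i => D n i ω) θ') →
      θhat n ω = 0) :
    TendstoInMeasure μ (fun n ω => polM1 m1 m2 (θhat n ω)) atTop (fun _ => (0:ℝ)) ∧
    TendstoInMeasure μ (fun n ω => polM2 m1 m2 (θhat n ω)) atTop (fun _ => (1:ℝ)) := by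
  have hk0 : 0 < k := by omega
  obtain ⟨a, b, hba, ha, hab⟩ := exists_expected_logitLoss_lt (by omega : 2 ≤ k) hζ hF
  have hmix := expected_mixed_pos (by omega : 2 ≤ k) hζ hp1
  have hr : Tendsto (fun n : ℕ => (m1 : ℝ) / m2 *
      exp (a / β * n - log ((m1 / ζ) / (m2 / (1 - ζ))))) atTop (nhds 0) := by
    have h1 : Tendsto (fun n : ℕ => a / β * (n : ℝ)) atTop atBot :=
      tendsto_natCast_atTop_atTop.const_mul_atTop_of_neg (div_neg_of_neg_of_pos ha hβ)
    have h2 := tendsto_exp_atBot.comp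
      (tendsto_atBot_add_const_right atTop (-log ((m1 / ζ) / (m2 / (1 - ζ)))) h1)
    simpa [Function.comp_def, sub_eq_add_neg] using h2.const_mul ((m1 : ℝ) / m2)
  have hM1 : TendstoInMeasure μ (fun n ω => polM1 m1 m2 (θhat n ω)) atTop (fun _ => (0:ℝ)) := by
    rw [tendstoInMeasure_iff_norm]
    intro ε hε
    refine tendsto_measure_of_two_sums μ D (datumProb ζ p1) _ _ (datumProb_nonneg hζ hp1)
      (sum_datumProb ζ p1) hiid hab hmix _ ?_
    filter_upwards [hr.eventually (gt_mem_nhds hε), eventually_gt_atTop 0] with n hn hn0 ω h1 h2 h3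
    rw [sum_sub_distrib, sub_pos] at h1
    obtain ⟨i, -, hi⟩ := exists_ne_zero_of_sum_ne_zero h2.ne'
    have hi' : (D n i ω).2 = true ∧ ∃ j, (D n i ω).1 j = false := by
      by_contra h
      exact hi (if_neg h)
    obtain ⟨t, ht⟩ := exists_min_sum_logitLoss hk0 (fun i => D n i ω) hba ha h1
      (fun i => exists_false_of_datumProb_ne_zero (h3 i)) ⟨i, hi'⟩
    have hsurj := relLogit_surjective (m1 := m1) (m2 := m2) (ζ := ζ) hβ hn0
    have hmin := hθmin n ω (by
      obtain ⟨θ, rfl⟩ := hsurj t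
      refine ⟨θ, fun θ' => ?_⟩
      rw [dpoLoss_eq_sum_logitLoss hk0 hm1 hm2 β hζ, dpoLoss_eq_sum_logitLoss hk0 hm1 hm2 β hζ]
      exact ht _)
    have hlt : relLogit m1 m2 ζ β n (θhat n ω) < a := by
      by_contra! hge
      obtain ⟨θ, hθ⟩ := hsurj b
      have := hmin θ
      rw [dpoLoss_eq_sum_logitLoss hk0 hm1 hm2 β hζ, dpoLoss_eq_sum_logitLoss hk0 hm1 hm2 β hζ,
        hθ] at this
      exact absurd (sum_logitLoss_lt hk0 (fun i => D n i ω) hba h1 hge) (not_lt.2 this)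
    have hnonneg : 0 ≤ polM1 m1 m2 (θhat n ω) := by
      unfold polM1
      positivity
    change ¬ ε ≤ ‖polM1 m1 m2 (θhat n ω) - 0‖
    rw [sub_zero, norm_of_nonneg hnonneg, not_le]
    exact (polM1_le hm2 hβ hn0 hlt).trans_lt hn
  refine ⟨hM1, ?_⟩
  rw [tendstoInMeasure_iff_norm] at hM1 ⊢
  intro ε hε
  convert hM1 ε hε using 6 with n ω
  rw [← polM1_add_polM2 (m2 := m2) hm1 (θhat n ω), sub_zero, norm_sub_rev]
  simp
end

section
/- (Lemma A.8, deterministic IL failure.) Fix an integer k ≥ 2 and, for i = 1,…,n, counts a_i ∈ {0,…,k}, b_i = k - a_i, and chosen categories c_i ∈ {1,2} with a_i ≥ 1 whenever c_i = 1 and b_i ≥ 1 whenever c_i = 2. Let I = {i : a_i ≥ 1 and b_i ≥ 1}, I1 = {i ∈ I : c_i = 1}, I2 = {i ∈ I : c_i = 2}. Fix β > 0 and p1, p2 > 0 with p1 + p2 = 1, and for q ∈ (0,1) and m > 0 define L(q, m) = -Σ_{i=1}^n ln( (m(1-q)·1(c_i=1) + q·1(c_i=2)) / (m(1-q) a_i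 + q b_i) ) + β[ (1-q) ln((1-q)/p1) + q ln(q/p2) ]. If |I1| > 1 and |I2| > max{1+β, 2β ln(p2/p1)}, then for each m > 0 the function L(·, m) attains a minimum on (0,1), and any choice of minimizers q_m satisfies q_m → 1 as m → ∞. -/
open Finset Real Filter

/-- The pointwise convexity bound behind the Gibbs inequality. -/
lemma sub_le_mul_log_div {x p : ℝ} (hx : 0 < x) (hp : 0 < p) : x - p ≤ x * log (x / p) := by
  have h := mul_le_mul_of_nonneg_left (one_sub_inv_le_log_of_pos (div_pos hx hp)) hx.le
  have e : x * (1 - (x / p)⁻¹) = x - p := by field_simp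
  linarith

lemma mul_log_div_le_neg_log {x p : ℝ} (hx : 0 < x) (hx1 : x ≤ 1) (hp : 0 < p) (hp1 : p ≤ 1) :
    x * log (x / p) ≤ -log p := by
  rw [log_div hx.ne' hp.ne']
  have h1 := log_nonpos hx.le hx1
  have h2 := log_nonpos hp.le hp1
  nlinarith

/-- The conditional probability, given the query, of the chosen message; `s` and `t` are the
(unnormalized) weights of a category-1 and a category-2 message. -/
noncomputable def choiceProb (a b : ℝ) (c : Bool) (s t : ℝ) : ℝ :=
  (s * (if c then 1 else 0) + t * (if c then 0 else 1)) / (s * a + t * b)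

section choiceProb

variable {a b s t : ℝ} {c : Bool}

lemma choiceProb_denom_pos (ha : 0 ≤ a) (hb : 0 ≤ b) (h1 : c = true → 1 ≤ a)
    (h2 : c = false → 1 ≤ b) (hs : 0 < s) (ht : 0 < t) : 0 < s * a + t * b := by
  cases c
  · have := h2 rfl
    positivity
  · have := h1 rfl
    positivity

lemma choiceProb_pos (ha : 0 ≤ a) (hb : 0 ≤ b) (h1 : c = true → 1 ≤ a)
    (h2 : c = false → 1 ≤ b) (hs : 0 < s) (ht : 0 < t) : 0 < choiceProb a b c s t := by
  have hd := choiceProb_denom_pos ha hb h1 h2 hs ht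
  apply div_pos _ hd
  cases c <;> simpa

lemma choiceProb_le_one (ha : 0 ≤ a) (hb : 0 ≤ b) (h1 : c = true → 1 ≤ a)
    (h2 : c = false → 1 ≤ b) (hs : 0 < s) (ht : 0 < t) : choiceProb a b c s t ≤ 1 := by
  have hd := choiceProb_denom_pos ha hb h1 h2 hs ht
  rw [choiceProb, div_le_one hd]
  cases c
  · have := h2 rfl
    simp only [Bool.false_eq_true, if_false]
    nlinarith [mul_nonneg hs.le ha]
  · have := h1 rfl
    simp only [if_true]
    nlinarith [mul_nonneg ht.le hb]

lemma choiceProb_true_le (ha : 0 ≤ a) (hb : 1 ≤ b) (hs : 0 < s) (ht : 0 < t) :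
    choiceProb a b true s t ≤ s / t := by
  simp only [choiceProb, if_true, mul_one, mul_zero, add_zero]
  gcongr
  nlinarith [mul_nonneg hs.le ha]

lemma choiceProb_false_le (ha : 1 ≤ a) (hb : 0 ≤ b) (hs : 0 < s) (ht : 0 < t) :
    choiceProb a b false s t ≤ t / s := by
  simp only [choiceProb, Bool.false_eq_true, if_false, mul_one, mul_zero, zero_add]
  gcongr
  nlinarith [mul_nonneg ht.le hb]

lemma choiceProb_self (hs : s ≠ 0) : choiceProb a b c s s = (a + b)⁻¹ := by
  cases c <;> simp [choiceProb, ← mul_add, div_mul_cancel_left₀ hs]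

end choiceProb

/-- **Lemma A.8 (deterministic IL failure).**  Fix an integer `k ≥ 2` and, for
`i = 1,…,n`, counts `a i ∈ {0,…,k}` of category-1 messages (`b i = k - a i`
category-2 messages) and chosen categories `c i` (`true` = category 1), with
`a i ≥ 1` whenever `c i = 1` and `b i ≥ 1` whenever `c i = 2`.  Let
`I = {i : a i ≥ 1 and b i ≥ 1}`, `I1 = {i ∈ I : c i = 1}`,
`I2 = {i ∈ I : c i = 2}`.  Fix `β > 0` and `p1, p2 > 0` with `p1 + p2 = 1`, and
for `q ∈ (0,1)`, `m > 0` define the inclusive-learning loss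
`L(q, m) = -Σ_i ln((m(1-q)·1(c_i=1) + q·1(c_i=2))/(m(1-q) a_i + q b_i))
          + β[(1-q) ln((1-q)/p1) + q ln(q/p2)]`.
If `|I1| > 1` and `|I2| > max{1+β, 2β ln(p2/p1)}`, then for each `m > 0` the
function `L(·, m)` attains a minimum on `(0,1)`, and any choice of minimizers
`q_m` satisfies `q_m → 1` as `m → ∞`. -/
theorem deterministic_il_failure
    (k n : ℕ) (hk : 2 ≤ k)
    (a : Fin n → ℕ) (c : Fin n → Bool)
    (ha : ∀ i, a i ≤ k)
    (hc1 : ∀ i, c i = true → 1 ≤ a i)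
    (hc2 : ∀ i, c i = false → a i < k)
    (β p1 p2 : ℝ) (hβ : 0 < β) (hp1 : 0 < p1) (hp2 : 0 < p2) (hp : p1 + p2 = 1)
    (hI1 : 1 < ((univ.filter fun i => 1 ≤ a i ∧ a i < k ∧ c i = true).card : ℝ))
    (hI2 : max (1 + β) (2 * β * Real.log (p2 / p1)) <
      ((univ.filter fun i => 1 ≤ a i ∧ a i < k ∧ c i = false).card : ℝ))
    (L : ℝ → ℝ → ℝ)
    (hL : ∀ q m, L q m =
      -∑ i, Real.log ((m * (1 - q) * (if c i then 1 else 0) + q * (if c i then 0 else 1)) /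
          (m * (1 - q) * (a i : ℝ) + q * ((k : ℝ) - (a i : ℝ)))) +
        β * ((1 - q) * Real.log ((1 - q) / p1) + q * Real.log (q / p2))) :
    (∀ m > (0:ℝ), ∃ q ∈ Set.Ioo (0:ℝ) 1, ∀ q' ∈ Set.Ioo (0:ℝ) 1, L q m ≤ L q' m) ∧
    (∀ qm : ℝ → ℝ,
      (∀ m > (0:ℝ), qm m ∈ Set.Ioo (0:ℝ) 1 ∧ ∀ q' ∈ Set.Ioo (0:ℝ) 1, L (qm m) m ≤ L q' m) →
      Tendsto qm atTop (nhds 1)) := by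
  have hP : ∀ q m, L q m =
      -∑ i, log (choiceProb (a i) ((k : ℝ) - a i) (c i) (m * (1 - q)) q) +
        β * ((1 - q) * log ((1 - q) / p1) + q * log (q / p2)) := hL
  clear hL
  have hA : ∀ i, (0 : ℝ) ≤ a i := fun i => Nat.cast_nonneg _
  have hB : ∀ i, (0 : ℝ) ≤ (k : ℝ) - a i := fun i => sub_nonneg.2 (by exact_mod_cast ha i)
  have hA1 : ∀ i, c i = true → (1 : ℝ) ≤ a i := fun i h => by exact_mod_cast hc1 i h
  have hB_of_lt : ∀ i, a i < k → (1 : ℝ) ≤ (k : ℝ) - a i := fun i h => by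
    have : ((a i + 1 : ℕ) : ℝ) ≤ k := by exact_mod_cast h
    push_cast at this
    linarith
  have hB1 : ∀ i, c i = false → (1 : ℝ) ≤ (k : ℝ) - a i := fun i h => hB_of_lt i (hc2 i h)
  obtain ⟨i₁, hi₁⟩ : (univ.filter fun i => 1 ≤ a i ∧ a i < k ∧ c i = true).Nonempty :=
    card_pos.1 (by exact_mod_cast zero_lt_one.trans hI1)
  obtain ⟨i₂, hi₂⟩ : (univ.filter fun i => 1 ≤ a i ∧ a i < k ∧ c i = false).Nonempty :=
    card_pos.1 (Nat.cast_pos.1 (lt_trans (by linarith) ((le_max_left _ _).trans_lt hI2)))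
  obtain ⟨-, hlt₁, hct₁⟩ := (mem_filter.1 hi₁).2
  obtain ⟨hle₂, -, hcf₂⟩ := (mem_filter.1 hi₂).2
  have term_le : ∀ m > (0 : ℝ), ∀ q ∈ Set.Ioo (0 : ℝ) 1, ∀ i,
      -log (choiceProb (a i) ((k : ℝ) - a i) (c i) (m * (1 - q)) q) ≤ L q m := by
    rintro m hm q ⟨hq0, hq1⟩ i
    have hs : 0 < m * (1 - q) := mul_pos hm (sub_pos.2 hq1)
    have hsum := single_le_sum (s := univ)
      (f := fun i => -log (choiceProb (a i) ((k : ℝ) - a i) (c i) (m * (1 - q)) q))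
      (fun j _ => neg_nonneg.2 (log_nonpos
        (choiceProb_pos (hA j) (hB j) (hA1 j) (hB1 j) hs hq0).le
        (choiceProb_le_one (hA j) (hB j) (hA1 j) (hB1 j) hs hq0))) (mem_univ i)
    rw [sum_neg_distrib] at hsum
    have hKL : 0 ≤ (1 - q) * log ((1 - q) / p1) + q * log (q / p2) := by
      linarith [sub_le_mul_log_div (sub_pos.2 hq1) hp1, sub_le_mul_log_div hq0 hp2]
    rw [hP]
    linarith [mul_nonneg hβ.le hKL]
  have lower_of_le : ∀ m > (0 : ℝ), ∀ q ∈ Set.Ioo (0 : ℝ) 1, ∀ B, L q m ≤ B →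
      m * (1 - q) ≤ exp B * q := by
    rintro m hm q ⟨hq0, hq1⟩ B hLB
    have hs : 0 < m * (1 - q) := mul_pos hm (sub_pos.2 hq1)
    have h := (term_le m hm q ⟨hq0, hq1⟩ i₂).trans hLB
    have hpos := choiceProb_pos (hA i₂) (hB i₂) (hA1 i₂) (hB1 i₂) hs hq0
    have hle := choiceProb_false_le (a := a i₂) (b := (k : ℝ) - a i₂)
      (by exact_mod_cast hle₂) (hB i₂) hs hq0
    rw [hcf₂] at h hpos
    have h' := log_le_log hpos hle
    rw [← div_le_iff₀ hq0, ← log_le_iff_le_exp (div_pos hs hq0), ← inv_div, log_inv]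
    linarith
  have upper_of_le : ∀ m > (0 : ℝ), ∀ q ∈ Set.Ioo (0 : ℝ) 1, ∀ B, L q m ≤ B →
      q ≤ exp B * (m * (1 - q)) := by
    rintro m hm q ⟨hq0, hq1⟩ B hLB
    have hs : 0 < m * (1 - q) := mul_pos hm (sub_pos.2 hq1)
    have h := (term_le m hm q ⟨hq0, hq1⟩ i₁).trans hLB
    have hpos := choiceProb_pos (hA i₁) (hB i₁) (hA1 i₁) (hB1 i₁) hs hq0
    have hle := choiceProb_true_le (hA i₁) (hB_of_lt i₁ hlt₁) hs hq0
    rw [hct₁] at h hpos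
    have h' := log_le_log hpos hle
    rw [← div_le_iff₀ hs, ← log_le_iff_le_exp (div_pos hq0 hs), ← inv_div, log_inv]
    linarith
  refine ⟨fun m hm => ?_, fun qm hqm => ?_⟩
  · set E := exp (L (1 / 2) m)
    have hE : 0 < E := exp_pos _
    have sublevel : ∀ q ∈ Set.Ioo (0 : ℝ) 1, L q m ≤ L (1 / 2) m →
        q ∈ Set.Icc (m / (m + E)) (E * m / (1 + E * m)) := by
      intro q hq h
      have h1 := lower_of_le m hm q hq _ h
      have h2 := upper_of_le m hm q hq _ h
      constructor
      · rw [div_le_iff₀ (by positivity)]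
        linarith
      · rw [le_div_iff₀ (by positivity)]
        linarith
    have hsub : Set.Icc (m / (m + E)) (E * m / (1 + E * m)) ⊆ Set.Ioo (0 : ℝ) 1 := by
      rintro q ⟨h1, h2⟩
      refine ⟨lt_of_lt_of_le (by positivity) h1, h2.trans_lt ?_⟩
      rw [div_lt_one (by positivity)]
      linarith
    have hcont : ContinuousOn (fun q => L q m) (Set.Ioo (0 : ℝ) 1) := by
      simp only [hP]
      refine .add (.neg (continuousOn_finsetSum _ fun i _ => .log ?_ ?_)) ?_
      · refine .div (by fun_prop) (by fun_prop) fun q hq => ?_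
        exact (choiceProb_denom_pos (hA i) (hB i) (hA1 i) (hB1 i)
          (mul_pos hm (sub_pos.2 hq.2)) hq.1).ne'
      · exact fun q hq => (choiceProb_pos (hA i) (hB i) (hA1 i) (hB1 i)
          (mul_pos hm (sub_pos.2 hq.2)) hq.1).ne'
      · refine .mul continuousOn_const (.add (.mul (by fun_prop) (.log (by fun_prop) ?_))
          (.mul (by fun_prop) (.log (by fun_prop) ?_)))
        · exact fun q hq => (div_pos (sub_pos.2 hq.2) hp1).ne'
        · exact fun q hq => (div_pos hq.1 hp2).ne'
    have hhalf := sublevel (1 / 2) (by norm_num) le_rfl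
    obtain ⟨q, hq, hmin⟩ := isCompact_Icc.exists_isMinOn ⟨_, hhalf⟩ (hcont.mono hsub)
    refine ⟨q, hsub hq, fun q' hq' => ?_⟩
    rcases le_total (L q' m) (L (1 / 2) m) with h | h
    · exact hmin (sublevel q' hq' h)
    · exact (hmin hhalf).trans h
  · set B := -∑ _i : Fin n, log ((k : ℝ)⁻¹) + β * (-log p1 + -log p2)
    have min_le : ∀ m > (0 : ℝ), L (qm m) m ≤ B := by
      intro m hm
      have ht : 0 < m / (1 + m) := by positivity
      have ht1 : m / (1 + m) < 1 := by
        rw [div_lt_one (by positivity)]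
        linarith
      refine ((hqm m hm).2 (m / (1 + m)) ⟨ht, ht1⟩).trans ?_
      have e : m * (1 - m / (1 + m)) = m / (1 + m) := by
        field_simp
        ring
      simp only [hP, e, choiceProb_self ht.ne', add_sub_cancel]
      have h1 := mul_log_div_le_neg_log (sub_pos.2 ht1) (by linarith) hp1 (by linarith)
      have h2 := mul_log_div_le_neg_log ht ht1.le hp2 (by linarith)
      exact add_le_add le_rfl (mul_le_mul_of_nonneg_left (add_le_add h1 h2) hβ.le)
    have hlim : Tendsto (fun m : ℝ => 1 - exp B / m) atTop (nhds 1) := by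
      simpa using tendsto_const_nhds.sub (tendsto_id.const_div_atTop (exp B))
    refine tendsto_of_tendsto_of_tendsto_of_le_of_le' hlim tendsto_const_nhds ?_ ?_
    · filter_upwards [eventually_gt_atTop 0] with m hm
      have hq := (hqm m hm).1
      have h := lower_of_le m hm _ hq _ (min_le m hm)
      have : 1 - qm m ≤ exp B / m := by
        rw [le_div_iff₀ hm]
        nlinarith [exp_pos B, hq.2]
      linarith
    · filter_upwards [eventually_gt_atTop 0] with m hm
      exact (hqm m hm).1.2.le
end
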